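/- arXiv:2004.08712 — 3 statements merged into one kernel-verified Lean document; each statement's English description precedes it below -/
import Mathlib

section
/- Let 0 ≤ p < 2, ε > 0, ξ = 6 Γ(2−p)²/Γ(4−2p), f(v) = 18 v²(1−v)², g₀(v) = 1/(ξ (v(1−v))^p) for v ∈ (0,1), and u(x) = ½(1 + tanh(3x/ε)). Then the transverse diffuse-interface energy integral ∫_ℝ g₀(u(x)) ((1/ε) f(u(x)) + (ε/2) (u'(x))²) dx converges and equals 1. -/
open MeasureTheory

theorem Real.hasDerivAt_tanh (x : ℝ) : HasDerivAt Real.tanh (1 - Real.tanh x ^ 2) x := by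
  have hc := (Real.cosh_pos x).ne'
  have h := (Real.hasDerivAt_sinh x).div (Real.hasDerivAt_cosh x) hc
  have he : Real.tanh = Real.sinh / Real.cosh := funext Real.tanh_eq_sinh_div_cosh
  rw [Real.tanh_eq_sinh_div_cosh, he]
  convert! h using 1
  field_simp

namespace ProbabilityTheory

theorem betaPDFReal_nonneg {α β : ℝ} (hα : 0 < α) (hβ : 0 < β) (x : ℝ) :
    0 ≤ betaPDFReal α β x := by
  by_cases hx : 0 < x ∧ x < 1
  · exact (betaPDFReal_pos hx.1 hx.2 hα hβ).le
  · simp [betaPDFReal, hx]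

theorem integrable_betaPDFReal {α β : ℝ} (hα : 0 < α) (hβ : 0 < β) :
    Integrable (betaPDFReal α β) := by
  refine ⟨(measurable_betaPDFReal α β).aestronglyMeasurable, ?_⟩
  rw [hasFiniteIntegral_iff_ofReal (.of_forall (betaPDFReal_nonneg hα hβ))]
  exact (lintegral_betaPDF_eq_one hα hβ).trans_lt ENNReal.one_lt_top

theorem integral_betaPDFReal {α β : ℝ} (hα : 0 < α) (hβ : 0 < β) :
    ∫ x, betaPDFReal α β x = 1 := by
  rw [integral_eq_lintegral_of_nonneg_ae (.of_forall (betaPDFReal_nonneg hα hβ))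
    (measurable_betaPDFReal α β).aestronglyMeasurable]
  exact (congrArg ENNReal.toReal (lintegral_betaPDF_eq_one hα hβ)).trans ENNReal.toReal_one

theorem setIntegral_Ioo_betaPDFReal {α β : ℝ} (hα : 0 < α) (hβ : 0 < β) :
    ∫ x in Set.Ioo 0 1, betaPDFReal α β x = 1 := by
  rw [setIntegral_eq_integral_of_forall_compl_eq_zero, integral_betaPDFReal hα hβ]
  intro x hx
  exact if_neg hx

end ProbabilityTheory

/-- For `0 ≤ p < 2`, `ξ = 6 Γ(2-p)²/Γ(4-2p)`,
`f(v) = 18 v²(1-v)²`, `g₀(v) = 1/(ξ (v(1-v))^p)` and the hyperbolic tangent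
profile `u(x) = (1 + tanh(3x/ε))/2`, the transverse diffuse-interface energy
`∫_ℝ g₀(u)((1/ε)f(u) + (ε/2)(u')²) dx` converges and equals 1. -/
theorem ddch_transverse_energy_equals_one
    (p ε ξ : ℝ) (hp0 : 0 ≤ p) (hp2 : p < 2) (hε : 0 < ε)
    (hξ : ξ = 6 * Real.Gamma (2 - p) ^ 2 / Real.Gamma (4 - 2 * p))
    (f : ℝ → ℝ) (hf : ∀ v, f v = 18 * v ^ 2 * (1 - v) ^ 2)
    (g₀ : ℝ → ℝ) (hg : ∀ v, v ∈ Set.Ioo (0:ℝ) 1 → g₀ v = 1 / (ξ * (v * (1 - v)) ^ p))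
    (u : ℝ → ℝ) (hu : ∀ x, u x = (1 + Real.tanh (3 * x / ε)) / 2) :
    Integrable (fun x : ℝ =>
      g₀ (u x) * ((1 / ε) * f (u x) + (ε / 2) * (deriv u x) ^ 2)) ∧
    (∫ x : ℝ,
      g₀ (u x) * ((1 / ε) * f (u x) + (ε / 2) * (deriv u x) ^ 2)) = 1 := by
  have hε' := hε.ne'
  have hα : 0 < 2 - p := by linarith
  have hu_mem : ∀ x, u x ∈ Set.Ioo (0 : ℝ) 1 := fun x ↦ by
    have h1 := Real.neg_one_lt_tanh (3 * x / ε)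
    have h2 := Real.tanh_lt_one (3 * x / ε)
    rw [hu]
    constructor <;> linarith
  have hu_deriv : ∀ x, HasDerivAt u (6 / ε * (u x * (1 - u x))) x := fun x ↦ by
    have hlin : HasDerivAt (fun y : ℝ ↦ 3 * y / ε) (3 / ε) x := by
      simpa using ((hasDerivAt_id x).const_mul 3).div_const ε
    have h := (((Real.hasDerivAt_tanh (3 * x / ε)).comp x hlin).const_add 1).div_const 2
    rw [hu x, show u = fun y ↦ (1 + Real.tanh (3 * y / ε)) / 2 from funext hu]
    convert! h using 1
    ring
  have hu_inj : Function.Injective u := fun x y hxy ↦ by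
    rw [hu, hu] at hxy
    have h : 3 * x / ε = 3 * y / ε := Real.tanh_injective (by linarith)
    field_simp at h
    linarith
  have hu_range : u '' Set.univ = Set.Ioo 0 1 := by
    refine Set.Subset.antisymm (by rintro _ ⟨x, -, rfl⟩; exact hu_mem x) fun v hv ↦ ?_
    have hv' : 2 * v - 1 ∈ Set.Ioo (-1 : ℝ) 1 := ⟨by linarith [hv.1], by linarith [hv.2]⟩
    refine ⟨ε / 3 * Real.artanh (2 * v - 1), trivial, ?_⟩
    rw [hu, show 3 * (ε / 3 * Real.artanh (2 * v - 1)) / ε = Real.artanh (2 * v - 1) by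
      field_simp, Real.tanh_artanh hv']
    ring
  have hξ_beta : ξ = 6 * ProbabilityTheory.beta (2 - p) (2 - p) := by
    rw [hξ, ProbabilityTheory.beta, show 2 - p + (2 - p) = 4 - 2 * p by ring]
    ring
  have h_integrand : (fun x ↦ g₀ (u x) * ((1 / ε) * f (u x) + (ε / 2) * (deriv u x) ^ 2)) =
      fun x ↦ |6 / ε * (u x * (1 - u x))| •
        ProbabilityTheory.betaPDFReal (2 - p) (2 - p) (u x) := by
    funext x
    obtain ⟨h0, h1⟩ := hu_mem x
    have h1' : 0 < 1 - u x := sub_pos.2 h1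
    have hb := (ProbabilityTheory.beta_pos hα hα).ne'
    rw [(hu_deriv x).deriv, hf, hg _ (hu_mem x), hξ_beta, ProbabilityTheory.betaPDFReal,
      if_pos ⟨h0, h1⟩, abs_of_pos (by positivity), smul_eq_mul,
      show 2 - p - 1 = 1 - p by ring, Real.rpow_sub h0, Real.rpow_sub h1',
      Real.rpow_one, Real.rpow_one, Real.mul_rpow h0.le h1'.le]
    have := (Real.rpow_pos_of_pos h0 p).ne'
    have := (Real.rpow_pos_of_pos h1' p).ne'
    field_simp
    ring
  rw [h_integrand]
  have hd : ∀ x ∈ Set.univ, HasDerivWithinAt u (6 / ε * (u x * (1 - u x))) Set.univ x :=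
    fun x _ ↦ (hu_deriv x).hasDerivWithinAt
  constructor
  · rw [← integrableOn_univ, ← integrableOn_image_iff_integrableOn_abs_deriv_smul
      MeasurableSet.univ hd hu_inj.injOn]
    exact (ProbabilityTheory.integrable_betaPDFReal hα hα).integrableOn
  · rw [← setIntegral_univ, ← integral_image_eq_integral_abs_deriv_smul
      MeasurableSet.univ hd hu_inj.injOn, hu_range,
      ProbabilityTheory.setIntegral_Ioo_betaPDFReal hα hα]
end

section
/- For C ≥ 0 define G_C : ℝ² → ℝ by G_C(p) = |p| + C (4(p₁⁴ + p₂⁴) − 3|p|⁴)/|p|³ for p ≠ 0 and G_C(0) = 0 (the positively one-homogeneous extension of the four-fold anisotropy γ₄(n̂) = 1 + C(4(n_x⁴ + n_y⁴) − 3)). Then: (i) if 0 ≤ C < 1/15, G_C is a convex function on ℝ²; (ii) if C > 1/15, G_C is not convex on ℝ². -/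
open Real in
theorem four_mul_cos_pow_add_sin_pow (t : ℝ) :
    4 * (cos t ^ 4 + sin t ^ 4) - 3 = cos (4 * t) := by
  have h : cos (4 * t) = 2 * (2 * cos t ^ 2 - 1) ^ 2 - 1 := by
    rw [← cos_two_mul, ← cos_two_mul]; ring_nf
  rw [h, show sin t ^ 4 = (sin t ^ 2) ^ 2 by ring, sin_sq]
  ring

open Real in
theorem cos_four_mul_eq (t : ℝ) : cos (4 * t) = 8 * cos t ^ 4 - 8 * cos t ^ 2 + 1 := by
  have h : cos (4 * t) = 2 * (2 * cos t ^ 2 - 1) ^ 2 - 1 := by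
    rw [← cos_two_mul, ← cos_two_mul]; ring_nf
  rw [h]; ring

open Real in
theorem sin_four_mul_eq (t : ℝ) : sin (4 * t) = 4 * sin t * cos t * (2 * cos t ^ 2 - 1) := by
  rw [show 4 * t = 2 * (2 * t) by ring, sin_two_mul, cos_two_mul, sin_two_mul]
  ring

theorem exists_polar (p : EuclideanSpace ℝ (Fin 2)) :
    ∃ t : ℝ, p 0 = ‖p‖ * Real.cos t ∧ p 1 = ‖p‖ * Real.sin t := by
  have h : ‖p‖ = ‖(⟨p 0, p 1⟩ : ℂ)‖ := by
    rw [EuclideanSpace.norm_eq, Complex.norm_eq_sqrt_sq_add_sq]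
    simp [Fin.sum_univ_two]
  refine ⟨Complex.arg ⟨p 0, p 1⟩, ?_, ?_⟩
  · rw [h, Complex.norm_mul_cos_arg]
  · rw [h, Complex.norm_mul_sin_arg]

/-- The graph of `1 + C cos 4θ` lies above each of its first-order tangents by sines and cosines. -/
theorem fourfold_tangent_le {C : ℝ} (hC : 0 ≤ C) (hC' : C < 1 / 15) (a t : ℝ) :
    (1 + C * Real.cos (4 * a)) * Real.cos t - 4 * C * Real.sin (4 * a) * Real.sin t ≤
      1 + C * Real.cos (4 * (a + t)) := by
  rw [mul_add, Real.cos_add (4 * a), cos_four_mul_eq t, sin_four_mul_eq t]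
  have hcs := Real.sin_sq_add_cos_sq (4 * a)
  have hxy := Real.sin_sq_add_cos_sq t
  have hx1 := Real.cos_le_one t
  generalize Real.cos (4 * a) = c at *
  generalize Real.sin (4 * a) = s at *
  generalize Real.cos t = x at *
  generalize Real.sin t = y at *
  have hpoly : (8 * x ^ 3 + 8 * x ^ 2 - 1) ^ 2 + (4 * y * (2 * x ^ 2 + 2 * x + 1)) ^ 2
      ≤ 15 ^ 2 := by
    have hy : y ^ 2 = 1 - x ^ 2 := by linarith
    have : (4 * y * (2 * x ^ 2 + 2 * x + 1)) ^ 2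
        = 16 * (1 - x ^ 2) * (2 * x ^ 2 + 2 * x + 1) ^ 2 := by
      rw [← hy]; ring
    rw [this]
    have hfac : 0 ≤ (1 - x) * (48 * (x + 3 / 2) ^ 2 + 100) :=
      mul_nonneg (by linarith) (by positivity)
    linear_combination hfac
  have hcauchy : c * (8 * x ^ 3 + 8 * x ^ 2 - 1) - s * (4 * y * (2 * x ^ 2 + 2 * x + 1)) ≤ 15 := by
    apply le_of_sq_le_sq _ (by norm_num)
    nlinarith [sq_nonneg (c * (4 * y * (2 * x ^ 2 + 2 * x + 1)) + s * (8 * x ^ 3 + 8 * x ^ 2 - 1))]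
  have hkey : 0 ≤ (1 - x) * (1 - C * (c * (8 * x ^ 3 + 8 * x ^ 2 - 1)
      - s * (4 * y * (2 * x ^ 2 + 2 * x + 1)))) := by
    apply mul_nonneg (by linarith)
    nlinarith [mul_le_mul_of_nonneg_left hcauchy hC]
  linear_combination hkey

section Fourfold

variable {C : ℝ} {G : EuclideanSpace ℝ (Fin 2) → ℝ}

theorem fourfold_eq_of_polar (hG0 : G 0 = 0)
    (hG : ∀ p : EuclideanSpace ℝ (Fin 2), p ≠ 0 →
      G p = ‖p‖ + C * (4 * ((p 0) ^ 4 + (p 1) ^ 4) - 3 * ‖p‖ ^ 4) / ‖p‖ ^ 3)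
    {p : EuclideanSpace ℝ (Fin 2)} {t : ℝ}
    (h0 : p 0 = ‖p‖ * Real.cos t) (h1 : p 1 = ‖p‖ * Real.sin t) :
    G p = ‖p‖ * (1 + C * Real.cos (4 * t)) := by
  rcases eq_or_ne p 0 with rfl | hp
  · simp [hG0]
  · have hn : ‖p‖ ≠ 0 := norm_ne_zero_iff.mpr hp
    rw [hG p hp, h0, h1, ← four_mul_cos_pow_add_sin_pow]
    field_simp

theorem fourfold_apply_polar (hG0 : G 0 = 0)
    (hG : ∀ p : EuclideanSpace ℝ (Fin 2), p ≠ 0 →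
      G p = ‖p‖ + C * (4 * ((p 0) ^ 4 + (p 1) ^ 4) - 3 * ‖p‖ ^ 4) / ‖p‖ ^ 3)
    {r : ℝ} (hr : 0 ≤ r) (t : ℝ) :
    G !₂[r * Real.cos t, r * Real.sin t] = r * (1 + C * Real.cos (4 * t)) := by
  have hn : ‖!₂[r * Real.cos t, r * Real.sin t]‖ = r := by
    rw [EuclideanSpace.norm_eq, Real.sqrt_eq_iff_mul_self_eq (by positivity) hr]
    simp only [Real.norm_eq_abs, sq_abs, Fin.sum_univ_two, Matrix.cons_val_zero,
      Matrix.cons_val_one]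
    linear_combination r ^ 2 * Real.sin_sq_add_cos_sq t
  have h := fourfold_eq_of_polar hG0 hG (p := !₂[r * Real.cos t, r * Real.sin t]) (t := t)
    (by simp [hn]) (by simp [hn])
  rwa [hn] at h

theorem fourfold_convexOn (hC : 0 ≤ C) (hC' : C < 1 / 15) (hG0 : G 0 = 0)
    (hG : ∀ p : EuclideanSpace ℝ (Fin 2), p ≠ 0 →
      G p = ‖p‖ + C * (4 * ((p 0) ^ 4 + (p 1) ^ 4) - 3 * ‖p‖ ^ 4) / ‖p‖ ^ 3) :
    ConvexOn ℝ Set.univ G := by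
  refine ⟨convex_univ, fun x _ y _ a b ha hb _ => ?_⟩
  obtain ⟨t, h0, h1⟩ := exists_polar (a • x + b • y)
  have hz := fourfold_eq_of_polar hG0 hG h0 h1
  have htangent : ∀ q : EuclideanSpace ℝ (Fin 2),
      (1 + C * Real.cos (4 * t)) * (Real.cos t * q 0 + Real.sin t * q 1)
        - 4 * C * Real.sin (4 * t) * (Real.cos t * q 1 - Real.sin t * q 0) ≤ G q := by
    intro q
    obtain ⟨u, hu0, hu1⟩ := exists_polar q
    have h := mul_le_mul_of_nonneg_left (fourfold_tangent_le hC hC' t (u - t)) (norm_nonneg q)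
    rw [add_sub_cancel, ← fourfold_eq_of_polar hG0 hG hu0 hu1, Real.cos_sub, Real.sin_sub] at h
    rw [hu0, hu1]
    linarith
  have hx := mul_le_mul_of_nonneg_left (htangent x) ha
  have hy := mul_le_mul_of_nonneg_left (htangent y) hb
  rw [hz]
  generalize ‖a • x + b • y‖ = r at *
  simp only [PiLp.add_apply, PiLp.smul_apply, smul_eq_mul] at h0 h1 ⊢
  refine le_trans (le_of_eq ?_) (add_le_add hx hy)
  linear_combination -r * (1 + C * Real.cos (4 * t)) * Real.sin_sq_add_cos_sq t
    - ((1 + C * Real.cos (4 * t)) * Real.cos t + 4 * C * Real.sin (4 * t) * Real.sin t) * h0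
    - ((1 + C * Real.cos (4 * t)) * Real.sin t - 4 * C * Real.sin (4 * t) * Real.cos t) * h1

theorem fourfold_not_convexOn (hC : 1 / 15 < C) (hG0 : G 0 = 0)
    (hG : ∀ p : EuclideanSpace ℝ (Fin 2), p ≠ 0 →
      G p = ‖p‖ + C * (4 * ((p 0) ^ 4 + (p 1) ^ 4) - 3 * ‖p‖ ^ 4) / ‖p‖ ^ 3) :
    ¬ ConvexOn ℝ Set.univ G := by
  intro h
  have hC0 : 0 < C := by linarith
  obtain ⟨e, he0, he1, heC⟩ : ∃ e : ℝ, 0 < e ∧ e < 1 ∧ 40 * (C * e) < 15 * C - 1 := by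
    refine ⟨(15 * C - 1) / (80 * C), div_pos (by linarith) (by linarith), ?_, ?_⟩
    · rw [div_lt_one (by linarith)]; linarith
    · have : C * ((15 * C - 1) / (80 * C)) = (15 * C - 1) / 80 := by field_simp
      rw [this]; linarith
  have hcos : Real.cos (Real.arccos (1 - e)) = 1 - e :=
    Real.cos_arccos (by linarith) (by linarith)
  set t := Real.arccos (1 - e)
  have hmid := h.2 (Set.mem_univ !₂[1 * Real.cos t, 1 * Real.sin t])
    (Set.mem_univ !₂[1 * Real.cos (-t), 1 * Real.sin (-t)])
    (by norm_num : (0 : ℝ) ≤ 1 / 2) (by norm_num : (0 : ℝ) ≤ 1 / 2) (by norm_num)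
  have hpt : (1 / 2 : ℝ) • !₂[1 * Real.cos t, 1 * Real.sin t]
      + (1 / 2 : ℝ) • !₂[1 * Real.cos (-t), 1 * Real.sin (-t)]
      = !₂[(1 - e) * Real.cos 0, (1 - e) * Real.sin 0] := by
    ext i
    fin_cases i
    · simp [hcos]; ring
    · simp
  rw [hpt, fourfold_apply_polar hG0 hG (by linarith), fourfold_apply_polar hG0 hG zero_le_one,
    fourfold_apply_polar hG0 hG zero_le_one, mul_neg, Real.cos_neg, cos_four_mul_eq t, hcos,
    mul_zero, Real.cos_zero, smul_eq_mul] at hmid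
  have hfactor : 0 ≤ e * (1 - C * (8 * (1 - e) ^ 3 + 8 * (1 - e) ^ 2 - 1)) := by
    linear_combination hmid
  have hpos := nonneg_of_mul_nonneg_right hfactor he0
  have hbern : 15 - 40 * e ≤ 8 * (1 - e) ^ 3 + 8 * (1 - e) ^ 2 - 1 := by
    nlinarith [mul_nonneg (sq_nonneg e) (sub_nonneg.mpr he1.le)]
  nlinarith [mul_le_mul_of_nonneg_left hbern hC0.le]

end Fourfold


/-- For `C ≥ 0` let `G_C` be the positively one-homogeneous
extension of the four-fold anisotropy `γ₄(n̂) = 1 + C(4(n_x⁴+n_y⁴) - 3)`,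
i.e. `G_C(p) = |p| + C(4(p₁⁴+p₂⁴) - 3|p|⁴)/|p|³` for `p ≠ 0` and `G_C(0)=0`.
Then `G_C` is convex on ℝ² iff the anisotropy is weak: it is convex for
`0 ≤ C < 1/15` and not convex for `C > 1/15`. -/
theorem fourfold_anisotropy_convexity_threshold
    (C : ℝ) (hC : 0 ≤ C)
    (G : EuclideanSpace ℝ (Fin 2) → ℝ)
    (hG0 : G 0 = 0)
    (hG : ∀ p : EuclideanSpace ℝ (Fin 2), p ≠ 0 →
      G p = ‖p‖ + C * (4 * ((p 0) ^ 4 + (p 1) ^ 4) - 3 * ‖p‖ ^ 4) / ‖p‖ ^ 3) :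
    (C < 1 / 15 → ConvexOn ℝ Set.univ G) ∧
    (1 / 15 < C → ¬ ConvexOn ℝ Set.univ G) := by
  exact ⟨fun h => fourfold_convexOn hC h hG0 hG, fun h => fourfold_not_convexOn h hG0 hG⟩
end

section
/- Let ε > 0, α > 0, ξ > 0, L > 0, f(v) = 18 v²(1−v)², g_α(v) = 1/√(ξ² v²(1−v)² + α²ε²), and M_α(v) = 36 v²(1−v)² + αε. Let u : ℝ × ℝ → ℝ be a smooth function that is L-periodic in the spatial variable x for each time t, define w(t,x) = g_α'(u)((ε/2) u_x² + (1/ε) f(u)) + g_α(u)(1/ε) f'(u) − ε ∂_x(g_α(u) u_x), and assume w(t,·) is L-periodic and that u satisfies ∂_t u = (1/ε) ∂_x(M_α(u) ∂_x w) on ℝ × ℝ. Then the free energy E(t) = ∫₀^L g_α(u(t,x)) ((1/ε) f(u(t,x)) + (ε/2) u_x(t,x)²) dx is differentiable in t with E'(t) = −(1/ε) ∫₀^L M_α(u(t,x)) (∂_x w(t,x))² dx ≤ 0; in particular E is non-increasing along solutions. -/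
open MeasureTheory intervalIntegral

open scoped ContDiff

theorem hasDerivAt_snd_of_contDiff {F : ℝ × ℝ → ℝ} (hF : ContDiff ℝ ∞ F) (t x : ℝ) :
    HasDerivAt (fun y => F (t, y)) (fderiv ℝ F (t, x) (0, 1)) x := by
  have h := (hF.differentiable (by simp) (t, x)).hasFDerivAt
  exact h.comp_hasDerivAt x ((hasDerivAt_const x t).prodMk (hasDerivAt_id x))

theorem hasDerivAt_fst_of_contDiff {F : ℝ × ℝ → ℝ} (hF : ContDiff ℝ ∞ F) (t x : ℝ) :
    HasDerivAt (fun s => F (s, x)) (fderiv ℝ F (t, x) (1, 0)) t := by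
  have h := (hF.differentiable (by simp) (t, x)).hasFDerivAt
  exact h.comp_hasDerivAt t ((hasDerivAt_id t).prodMk (hasDerivAt_const t x))

theorem contDiff_fderiv_apply_const {F : ℝ × ℝ → ℝ} (hF : ContDiff ℝ ∞ F) (v : ℝ × ℝ) :
    ContDiff ℝ ∞ (fun q => fderiv ℝ F q v) :=
  (hF.fderiv_right (by simp)).clm_apply contDiff_const

theorem contDiff_deriv_snd {F : ℝ × ℝ → ℝ} (hF : ContDiff ℝ ∞ F) :
    ContDiff ℝ ∞ (fun q : ℝ × ℝ => deriv (fun y => F (q.1, y)) q.2) := by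
  have h : (fun q : ℝ × ℝ => deriv (fun y => F (q.1, y)) q.2) =
      fun q => fderiv ℝ F q (0, 1) :=
    funext fun q => (hasDerivAt_snd_of_contDiff hF q.1 q.2).deriv
  exact h ▸ contDiff_fderiv_apply_const hF _

theorem contDiff_deriv_fst {F : ℝ × ℝ → ℝ} (hF : ContDiff ℝ ∞ F) :
    ContDiff ℝ ∞ (fun q : ℝ × ℝ => deriv (fun s => F (s, q.2)) q.1) := by
  have h : (fun q : ℝ × ℝ => deriv (fun s => F (s, q.2)) q.1) =
      fun q => fderiv ℝ F q (1, 0) :=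
    funext fun q => (hasDerivAt_fst_of_contDiff hF q.1 q.2).deriv
  exact h ▸ contDiff_fderiv_apply_const hF _

/-- Symmetry of mixed partial derivatives. -/
theorem deriv_fst_deriv_snd_comm {F : ℝ × ℝ → ℝ} (hF : ContDiff ℝ ∞ F) (t x : ℝ) :
    deriv (fun s => deriv (fun y => F (s, y)) x) t =
      deriv (fun y => deriv (fun s => F (s, y)) t) x := by
  have hd : DifferentiableAt ℝ (fderiv ℝ F) (t, x) :=
    (hF.fderiv_right (m := ∞) (by simp)).differentiable (by simp) _
  have happ : ∀ v w : ℝ × ℝ,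
      fderiv ℝ (fun q => fderiv ℝ F q v) (t, x) w = fderiv ℝ (fderiv ℝ F) (t, x) w v := by
    intro v w
    rw [fderiv_clm_apply hd (differentiableAt_const v)]
    simp
  have hsymm : IsSymmSndFDerivAt ℝ F (t, x) :=
    hF.contDiffAt.isSymmSndFDerivAt
      (by simpa using (WithTop.coe_le_coe.2 le_top : ((2 : ℕ∞) : WithTop ℕ∞) ≤ ∞))
  simp_rw [fun s => (hasDerivAt_snd_of_contDiff hF s x).deriv,
    fun y => (hasDerivAt_fst_of_contDiff hF t y).deriv]
  rw [(hasDerivAt_fst_of_contDiff (contDiff_fderiv_apply_const hF (0, 1)) t x).deriv,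
    (hasDerivAt_snd_of_contDiff (contDiff_fderiv_apply_const hF (1, 0)) t x).deriv, happ, happ]
  exact hsymm (1, 0) (0, 1)

/-- Differentiation under the integral sign for a smooth integrand. -/
theorem hasDerivAt_integral_of_contDiff {F : ℝ × ℝ → ℝ} (hF : ContDiff ℝ ∞ F) (a b t : ℝ) :
    HasDerivAt (fun s => ∫ x in a..b, F (s, x))
      (∫ x in a..b, deriv (fun s => F (s, x)) t) t := by
  have hF' := (contDiff_deriv_fst hF).continuous
  obtain ⟨C, hC⟩ := ((isCompact_closedBall t 1).prod (isCompact_uIcc (a := a) (b := b))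
    ).exists_bound_of_continuousOn hF'.continuousOn
  have hslice : ∀ s, Continuous fun x => F (s, x) := fun s => hF.continuous.comp (by fun_prop)
  have hslice' : Continuous fun x => deriv (fun s => F (s, x)) t :=
    hF'.comp (by fun_prop : Continuous fun x : ℝ => (t, x))
  refine (intervalIntegral.hasDerivAt_integral_of_dominated_loc_of_deriv_le
    (F := fun s x => F (s, x)) (F' := fun s x => deriv (fun s => F (s, x)) s)
    (bound := fun _ => C) (Metric.ball_mem_nhds t one_pos)
    (Filter.Eventually.of_forall fun s => (hslice s).aestronglyMeasurable)
    ((hslice t).intervalIntegrable _ _) hslice'.aestronglyMeasurable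
    (Filter.Eventually.of_forall fun x hx s hs => ?_) intervalIntegrable_const
    (Filter.Eventually.of_forall fun x _ s _ => ?_)).2
  · exact hC (s, x) ⟨Metric.ball_subset_closedBall hs, Set.uIoc_subset_uIcc hx⟩
  · exact (hasDerivAt_fst_of_contDiff hF s x).differentiableAt.hasDerivAt

theorem deriv_add_period {h : ℝ → ℝ} {L : ℝ} (hper : ∀ x, h (x + L) = h x) (x : ℝ) :
    deriv h (x + L) = deriv h x := by
  rw [← deriv_comp_add_const, funext hper]

/-- Energy dissipation for the 1D spatially `L`-periodic
regularised isotropic DDCH model: if `u` is a smooth `L`-periodic solution of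
`∂_t u = (1/ε) ∂_x (M_α(u) ∂_x w)` with variational chemical potential
`w = g_α'(u)((ε/2)u_x² + (1/ε)f(u)) + g_α(u)(1/ε)f'(u) − ε ∂_x(g_α(u)u_x)`,
then `E(t) = ∫₀ᴸ g_α(u)((1/ε)f(u) + (ε/2)u_x²) dx` satisfies
`E'(t) = −(1/ε)∫₀ᴸ M_α(u)(∂_x w)² dx ≤ 0`; in particular `E` is
non-increasing. -/
theorem ddch_isotropic_energy_dissipation_1d_periodic
    (ε α ξ L : ℝ) (hε : 0 < ε) (hα : 0 < α) (hξ : 0 < ξ) (hL : 0 < L)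
    (f : ℝ → ℝ) (hf : ∀ v, f v = 18 * v ^ 2 * (1 - v) ^ 2)
    (g : ℝ → ℝ)
    (hg : ∀ v, g v = 1 / Real.sqrt (ξ ^ 2 * v ^ 2 * (1 - v) ^ 2 + α ^ 2 * ε ^ 2))
    (M : ℝ → ℝ) (hM : ∀ v, M v = 36 * v ^ 2 * (1 - v) ^ 2 + α * ε)
    (u : ℝ → ℝ → ℝ) (hu : ContDiff ℝ (⊤ : ℕ∞) (fun q : ℝ × ℝ => u q.1 q.2))
    (huper : ∀ t x, u t (x + L) = u t x)
    (w : ℝ → ℝ → ℝ)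
    (hw : ∀ t x, w t x =
      deriv g (u t x) * ((ε / 2) * (deriv (u t) x) ^ 2 + (1 / ε) * f (u t x)) +
        g (u t x) * (1 / ε) * deriv f (u t x) -
        ε * deriv (fun y => g (u t y) * deriv (u t) y) x)
    (hwper : ∀ t x, w t (x + L) = w t x)
    (hpde : ∀ t x, deriv (fun s => u s x) t =
      (1 / ε) * deriv (fun y => M (u t y) * deriv (w t) y) x)
    (E : ℝ → ℝ)
    (hE : ∀ t, E t = ∫ x in (0:ℝ)..L,
      g (u t x) * ((1 / ε) * f (u t x) + (ε / 2) * (deriv (u t) x) ^ 2)) :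
    (∀ t : ℝ,
      HasDerivAt E (-(1 / ε) * ∫ x in (0:ℝ)..L, M (u t x) * (deriv (w t) x) ^ 2) t ∧
      -(1 / ε) * (∫ x in (0:ℝ)..L, M (u t x) * (deriv (w t) x) ^ 2) ≤ 0) ∧
    Antitone E := by
  have hfs : ContDiff ℝ ∞ f := by
    rw [funext hf]; fun_prop
  have hMs : ContDiff ℝ ∞ M := by
    rw [funext hM]; fun_prop
  have hpos : ∀ v : ℝ, 0 < ξ ^ 2 * v ^ 2 * (1 - v) ^ 2 + α ^ 2 * ε ^ 2 := fun v => by positivity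
  have hgs : ContDiff ℝ ∞ g := by
    rw [funext hg]
    exact contDiff_const.div (ContDiff.sqrt (by fun_prop) fun v => (hpos v).ne')
      fun v => (Real.sqrt_pos.2 (hpos v)).ne'
  have hMnn : ∀ v, 0 ≤ M v := fun v => by rw [hM]; positivity
  have hg's : ContDiff ℝ ∞ (deriv g) := (contDiff_infty_iff_deriv.1 hgs).2
  have hf's : ContDiff ℝ ∞ (deriv f) := (contDiff_infty_iff_deriv.1 hfs).2
  have hux : ContDiff ℝ ∞ (fun q : ℝ × ℝ => deriv (u q.1) q.2) := contDiff_deriv_snd hu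
  have hut : ContDiff ℝ ∞ (fun q : ℝ × ℝ => deriv (fun s => u s q.2) q.1) :=
    contDiff_deriv_fst hu
  have hflux : ContDiff ℝ ∞ (fun q : ℝ × ℝ => g (u q.1 q.2) * deriv (u q.1) q.2) :=
    (hgs.comp hu).mul hux
  have hws : ContDiff ℝ ∞ (fun q : ℝ × ℝ => w q.1 q.2) := by
    simp_rw [hw]
    exact (((hg's.comp hu).mul ((contDiff_const.mul (hux.pow 2)).add
      (contDiff_const.mul (hfs.comp hu)))).add
      (((hgs.comp hu).mul contDiff_const).mul (hf's.comp hu))).sub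
      (contDiff_const.mul (contDiff_deriv_snd hflux))
  have hwx : ContDiff ℝ ∞ (fun q : ℝ × ℝ => deriv (w q.1) q.2) := contDiff_deriv_snd hws
  have hMw : ContDiff ℝ ∞ (fun q : ℝ × ℝ => M (u q.1 q.2) * deriv (w q.1) q.2) :=
    (hMs.comp hu).mul hwx
  have he : ContDiff ℝ ∞ (fun q : ℝ × ℝ => g (u q.1 q.2) *
      ((1 / ε) * f (u q.1 q.2) + (ε / 2) * (deriv (u q.1) q.2) ^ 2)) :=
    (hgs.comp hu).mul ((contDiff_const.mul (hfs.comp hu)).add (contDiff_const.mul (hux.pow 2)))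
  have dx : ∀ {F : ℝ × ℝ → ℝ}, ContDiff ℝ ∞ F → ∀ t x,
      HasDerivAt (fun y => F (t, y)) (deriv (fun y => F (t, y)) x) x := fun hF t x =>
    (hasDerivAt_snd_of_contDiff hF t x).differentiableAt.hasDerivAt
  have dt : ∀ {F : ℝ × ℝ → ℝ}, ContDiff ℝ ∞ F → ∀ t x,
      HasDerivAt (fun s => F (s, x)) (deriv (fun s => F (s, x)) t) t := fun hF t x =>
    (hasDerivAt_fst_of_contDiff hF t x).differentiableAt.hasDerivAt
  have hderiv : ∀ t : ℝ,
      HasDerivAt E (-(1 / ε) * ∫ x in (0:ℝ)..L, M (u t x) * (deriv (w t) x) ^ 2) t := by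
    intro t
    have hE' := hasDerivAt_integral_of_contDiff he 0 L t
    rw [← funext hE] at hE'
    convert hE' using 1
    set Φ : ℝ → ℝ := fun x => ε * (g (u t x) * deriv (u t) x * deriv (fun s => u s x) t) +
      (1 / ε) * (w t x * (M (u t x) * deriv (w t) x)) with hΦ
    have hΦd : ∀ x, HasDerivAt Φ (deriv (fun s => g (u s x) *
        ((1 / ε) * f (u s x) + (ε / 2) * (deriv (u s) x) ^ 2)) t +
        (1 / ε) * (M (u t x) * (deriv (w t) x) ^ 2)) x := by
      intro x
      have hut' := dt hu t x
      have hgd := ((contDiff_infty_iff_deriv.1 hgs).1 (u t x)).hasDerivAt.comp t hut'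
      have hfd := ((contDiff_infty_iff_deriv.1 hfs).1 (u t x)).hasDerivAt.comp t hut'
      have hed := (hgd.mul ((hfd.const_mul (1 / ε)).add
        (((dt hux t x).pow 2).const_mul (ε / 2)))).deriv
      have hΦ' := (((dx hflux t x).mul (dx hut t x)).const_mul ε).add
        (((dx hws t x).mul (dx hMw t x)).const_mul (1 / ε))
      have hcomm : deriv (fun s => deriv (u s) x) t =
          deriv (fun y => deriv (fun s => u s y) t) x :=
        deriv_fst_deriv_snd_comm hu t x
      have hwt := hw t x
      have hp := hpde t x
      refine hΦ'.congr_deriv ?_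
      refine Eq.trans ?_ (congrArg (· + _) hed.symm)
      simp only [Pi.add_apply, Pi.pow_apply, Function.comp_apply]
      push_cast
      linear_combination deriv (fun s => u s x) t * hwt - w t x * hp -
        ε * g (u t x) * deriv (u t) x * hcomm
    have hcont1 : Continuous fun x => deriv (fun s => g (u s x) *
        ((1 / ε) * f (u s x) + (ε / 2) * (deriv (u s) x) ^ 2)) t :=
      (contDiff_deriv_fst he).continuous.comp (by fun_prop : Continuous fun x : ℝ => (t, x))
    have hcont2 : Continuous fun x => M (u t x) * (deriv (w t) x) ^ 2 :=
      (((hMs.comp hu).mul (hwx.pow 2)).continuous).comp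
        (by fun_prop : Continuous fun x : ℝ => (t, x))
    have hint := intervalIntegral.integral_eq_sub_of_hasDerivAt (a := 0) (b := L)
      (fun x _ => hΦd x) ((hcont1.add (hcont2.const_mul (1 / ε))).intervalIntegrable _ _)
    have hper : Φ L = Φ 0 := by
      have h0 : ∀ {h : ℝ → ℝ}, (∀ x, h (x + L) = h x) → h L = h 0 := fun hh => by
        simpa using hh 0
      have hutper : ∀ x, deriv (fun s => u s (x + L)) t = deriv (fun s => u s x) t := fun x => by
        simp_rw [huper]
      simp only [hΦ]
      rw [h0 (huper t), h0 (hwper t), h0 (deriv_add_period (huper t)),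
        h0 (deriv_add_period (hwper t)), h0 (h := fun x => deriv (fun s => u s x) t) hutper]
    rw [intervalIntegral.integral_add (hcont1.intervalIntegrable _ _)
      ((hcont2.const_mul (1 / ε)).intervalIntegrable _ _),
      intervalIntegral.integral_const_mul, hper, sub_self] at hint
    linarith
  have hnonpos : ∀ t : ℝ,
      -(1 / ε) * (∫ x in (0:ℝ)..L, M (u t x) * (deriv (w t) x) ^ 2) ≤ 0 := fun t =>
    mul_nonpos_of_nonpos_of_nonneg (neg_nonpos.2 (by positivity))
      (intervalIntegral.integral_nonneg hL.le fun x _ => mul_nonneg (hMnn _) (sq_nonneg _))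
  exact ⟨fun t => ⟨hderiv t, hnonpos t⟩,
    antitone_of_hasDerivAt_nonpos hderiv hnonpos⟩
end
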